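/- Let N_1, …, N_9 ⊆ {1, …, 9} be the column index sets N_1 = {1,3,5,6,7,8}, N_2 = {1,2,3,5,8,9}, N_3 = {1,2,4,5,6,7}, N_4 = {1,2,4,7,8,9}, N_5 = {1,3,4,6,9}, N_6 = {3,4,5,7,8,9}, N_7 = {2,4,5,6,8,9}, N_8 = {2,3,5,6,7,9}, N_9 = {2,3,4,6,7,8}. Then there is no matrix S ∈ ℚ^{9×9} satisfying S_{ij} ≠ 0 if j ∈ N_i, S_{ij} = 0 if j ∉ N_i, and rank(S) ≤ 3. -/

import Mathlib

open Matrix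

/-- For each point (row) `i` of the non-rational 9-point, 9-line configuration
of Grünbaum, the set of lines (columns) `j` not passing through it, i.e. the
columns where the matrix must be nonzero (0-indexed). -/
def N18 : Fin 9 → Finset (Fin 9) :=
  ![{0,2,4,5,6,7}, {0,1,2,4,7,8}, {0,1,3,4,5,6}, {0,1,3,6,7,8}, {0,2,3,5,8},
    {2,3,4,6,7,8}, {1,3,4,5,7,8}, {1,2,4,5,6,8}, {1,2,3,5,6,7}]

/-- Every square submatrix larger than the rank is singular. -/
theorem Matrix.det_submatrix_eq_zero_of_rank_lt {m n k K : Type*} [Fintype m] [Fintype n]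
    [Fintype k] [DecidableEq k] [Field K] (A : Matrix m n K) (r : k → m) (c : k → n)
    (h : A.rank < Fintype.card k) : (A.submatrix r c).det = 0 := by
  by_contra hdet
  have hrank := rank_of_isUnit (A.submatrix r c)
    ((isUnit_iff_isUnit_det _).2 (isUnit_iff_ne_zero.2 hdet))
  have hle := A.rank_submatrix_le r c
  lia

/-- In a matrix of rank at most three, a diagonal invertible `3 × 3` block determines
all other entries. -/
theorem Matrix.apply_eq_of_rank_le_three {m n K : Type*} [Fintype m] [Fintype n] [Field K]
    (A : Matrix m n K) (hA : A.rank ≤ 3) {r₀ r₁ r₂ : m} {c₀ c₁ c₂ : n}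
    (h01 : A r₀ c₁ = 0) (h02 : A r₀ c₂ = 0) (h10 : A r₁ c₀ = 0) (h12 : A r₁ c₂ = 0)
    (h20 : A r₂ c₀ = 0) (h21 : A r₂ c₁ = 0)
    (h00 : A r₀ c₀ ≠ 0) (h11 : A r₁ c₁ ≠ 0) (h22 : A r₂ c₂ ≠ 0) (i : m) (j : n) :
    A i j = A i c₀ * (A r₀ j / A r₀ c₀) + A i c₁ * (A r₁ j / A r₁ c₁)
      + A i c₂ * (A r₂ j / A r₂ c₂) := by
  have h := A.det_submatrix_eq_zero_of_rank_lt ![r₀, r₁, r₂, i] ![c₀, c₁, c₂, j]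
    (by simpa using Nat.lt_succ_of_le hA)
  rw [det_succ_row_zero] at h
  simp only [Fin.sum_univ_four, det_fin_three, submatrix_apply] at h
  simp [Fin.succAbove, h01, h02, h10, h12, h20, h21] at h
  field_simp
  linear_combination h

/-- Two vectors orthogonal to a common vector with a nonzero coordinate are parallel. -/
theorem mul_eq_mul_of_mul_add_mul_eq_zero {K : Type*} [Field K] {b c x y z w : K} (hb : b ≠ 0)
    (h : x * b + y * c = 0) (h' : z * b + w * c = 0) : x * w = z * y := by
  apply mul_right_cancel₀ hb
  linear_combination w * h - y * h'

theorem Rat.sq_add_mul_sub_sq_ne_zero {a b : ℚ} (hb : b ≠ 0) : a ^ 2 + a * b - b ^ 2 ≠ 0 := by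
  intro h
  have h5 : IsSquare (5 : ℚ) := ⟨(2 * a + b) / b, by field_simp; linear_combination -4 * h⟩
  norm_num at h5

/-- there is no rational `9 × 9` matrix of rank at most 3 whose
`(i, j)` entry is nonzero exactly when `j ∈ N18 i`; i.e. the configuration has
no rational realization. -/
theorem statement_18 :
    ¬ ∃ S : Matrix (Fin 9) (Fin 9) ℚ,
        (∀ i j, S i j ≠ 0 ↔ j ∈ N18 i) ∧ S.rank ≤ 3 := by
  rintro ⟨S, hS, hrank⟩
  have nz (i j) (h : j ∈ N18 i) : S i j ≠ 0 := (hS i j).2 h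
  have z (i j) (h : j ∉ N18 i) : S i j = 0 := by
    by_contra h0
    exact h ((hS i j).1 h0)
  have key := S.apply_eq_of_rank_le_three hrank (r₀ := 4) (r₁ := 5) (r₂ := 6)
    (c₀ := 0) (c₁ := 6) (c₂ := 1)
    (z _ _ (by decide)) (z _ _ (by decide)) (z _ _ (by decide)) (z _ _ (by decide))
    (z _ _ (by decide)) (z _ _ (by decide)) (nz _ _ (by decide)) (nz _ _ (by decide))
    (nz _ _ (by decide))
  have inc (i j) (h : j ∉ N18 i) := (key i j).symm.trans (z i j h)
  have a3 : S 4 3 / S 4 0 ≠ 0 := div_ne_zero (nz _ _ (by decide)) (nz _ _ (by decide))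
  have a5 : S 4 5 / S 4 0 ≠ 0 := div_ne_zero (nz _ _ (by decide)) (nz _ _ (by decide))
  have a8 : S 4 8 / S 4 0 ≠ 0 := div_ne_zero (nz _ _ (by decide)) (nz _ _ (by decide))
  have a2 : S 4 2 / S 4 0 ≠ 0 := div_ne_zero (nz _ _ (by decide)) (nz _ _ (by decide))
  have b4 : S 5 4 / S 5 6 ≠ 0 := div_ne_zero (nz _ _ (by decide)) (nz _ _ (by decide))
  have b7 : S 5 7 / S 5 6 ≠ 0 := div_ne_zero (nz _ _ (by decide)) (nz _ _ (by decide))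
  have z44 : S 4 4 = 0 := z _ _ (by decide)
  have z47 : S 4 7 = 0 := z _ _ (by decide)
  have z55 : S 5 5 = 0 := z _ _ (by decide)
  have z62 : S 6 2 = 0 := z _ _ (by decide)
  have z01 : S 0 1 = 0 := z _ _ (by decide)
  have z16 : S 1 6 = 0 := z _ _ (by decide)
  have z70 : S 7 0 = 0 := z _ _ (by decide)
  have z80 : S 8 0 = 0 := z _ _ (by decide)
  have line2 : S 2 0 * S 3 6 = S 3 0 * S 2 6 :=
    mul_eq_mul_of_mul_add_mul_eq_zero a2
      (by simpa [z62] using inc 2 2 (by decide)) (by simpa [z62] using inc 3 2 (by decide))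
  have line5 : S 1 0 * S 3 1 = S 3 0 * S 1 1 :=
    mul_eq_mul_of_mul_add_mul_eq_zero a5
      (by simpa [z55] using inc 1 5 (by decide)) (by simpa [z55] using inc 3 5 (by decide))
  have line4 : S 3 6 * S 8 1 = S 8 6 * S 3 1 :=
    mul_eq_mul_of_mul_add_mul_eq_zero b4
      (by simpa [z44] using inc 3 4 (by decide)) (by simpa [z44] using inc 8 4 (by decide))
  have line7 : S 2 6 * S 7 1 = S 7 6 * S 2 1 :=
    mul_eq_mul_of_mul_add_mul_eq_zero b7
      (by simpa [z47] using inc 2 7 (by decide)) (by simpa [z47] using inc 7 7 (by decide))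
  have line3 : S 0 0 * S 1 1 * S 7 6 + S 0 6 * S 1 0 * S 7 1 = 0 := by
    have e0 := inc 0 3 (by decide)
    have e1 := inc 1 3 (by decide)
    have e7 := inc 7 3 (by decide)
    rw [z01] at e0
    rw [z16] at e1
    rw [z70] at e7
    refine (mul_eq_zero.1 ?_).resolve_left a3
    linear_combination S 1 1 * S 7 6 * e0 + S 0 6 * S 7 1 * e1 - S 0 6 * S 1 1 * e7
  have line8 : S 0 0 * (S 2 6 * S 8 1 - S 2 1 * S 8 6) - S 0 6 * S 2 0 * S 8 1 = 0 := by
    have e0 := inc 0 8 (by decide)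
    have e2 := inc 2 8 (by decide)
    have e8 := inc 8 8 (by decide)
    rw [z01] at e0
    rw [z80] at e8
    refine (mul_eq_zero.1 ?_).resolve_left a8
    linear_combination (S 2 6 * S 8 1 - S 2 1 * S 8 6) * e0 - S 0 6 * S 8 1 * e2
      + S 0 6 * S 2 1 * e8
  have h37 : S 2 1 * S 0 6 * S 1 0 = -(S 2 6 * S 1 1 * S 0 0) := by
    apply mul_left_cancel₀ (nz 7 6 (by decide))
    linear_combination S 2 6 * line3 - S 0 6 * S 1 0 * line7
  have h245 : S 1 0 * S 2 6 * S 8 1 = S 2 0 * S 8 6 * S 1 1 := by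
    apply mul_left_cancel₀ (nz 3 0 (by decide))
    linear_combination S 2 0 * S 1 0 * line4 + S 2 0 * S 8 6 * line5 - S 1 0 * S 8 1 * line2
  apply Rat.sq_add_mul_sub_sq_ne_zero (a := S 0 0 * S 2 6) (b := S 2 0 * S 0 6)
    (mul_ne_zero (nz _ _ (by decide)) (nz _ _ (by decide)))
  apply mul_left_cancel₀ (mul_ne_zero (nz 1 0 (by decide)) (nz 8 1 (by decide)))
  linear_combination S 1 0 * S 0 6 * S 2 0 * line8 + S 0 0 * S 2 0 * S 8 6 * h37
    + S 0 0 ^ 2 * S 2 6 * h245
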